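/- arXiv:1809.04530 — 12 statements merged into one kernel-verified Lean document; each statement's English description precedes it below -/
import Mathlib

section
/- Let f : ℝ → ℝ be continuously differentiable and suppose there exist real numbers a < b such that: (a) f′(x) < 0 for all x ≤ a and f′(x) > 0 for all x ≥ b; (b) f′ is strictly increasing on (−∞, a] and unbounded below on (−∞, a]; (c) f′ is strictly increasing on [b, ∞) and unbounded above on [b, ∞). Then there exists t₀ > 0 such that for every t ≥ t₀ the function x ↦ μ(x,t) is strictly convex on ℝ. -/
theorem hasDerivAt_integral_sub_add {f : ℝ → ℝ} (hf : Continuous f) (t y : ℝ) :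
    HasDerivAt (fun y : ℝ => ∫ τ in (y - t)..(y + t), f τ) (f (y + t) - f (y - t)) y := by
  have hF (x : ℝ) : HasDerivAt (fun x : ℝ => ∫ τ in (0 : ℝ)..x, f τ) (f x) x :=
    hf.integral_hasStrictDerivAt 0 x |>.hasDerivAt
  have heq : (fun y : ℝ => ∫ τ in (y - t)..(y + t), f τ) =
      fun y => (∫ τ in (0 : ℝ)..(y + t), f τ) - ∫ τ in (0 : ℝ)..(y - t), f τ := by
    funext y
    exact (intervalIntegral.integral_interval_sub_left (hf.intervalIntegrable _ _)
      (hf.intervalIntegrable _ _)).symm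
  rw [heq]
  exact ((hF (y + t)).comp_add_const y t).sub ((hF (y - t)).comp_sub_const y t)

/-- The Steklov function of `f` is strictly convex as soon as the derivative of `f` increases
strictly across every interval of length `2 * t`. -/
theorem strictConvexOn_steklov {f : ℝ → ℝ} (hf : Differentiable ℝ f) {t : ℝ} (ht : 0 < t)
    (h : ∀ y, deriv f (y - t) < deriv f (y + t)) :
    StrictConvexOn ℝ Set.univ
      (fun y : ℝ => (1 / (2 * t)) * ∫ τ in (y - t)..(y + t), f τ) := by
  have hd (y : ℝ) := (hasDerivAt_integral_sub_add hf.continuous t y).const_mul (1 / (2 * t))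
  refine StrictMono.strictConvexOn_univ_of_deriv
    (continuous_iff_continuousAt.2 fun y => (hd y).continuousAt) ?_
  rw [funext fun y => (hd y).deriv]
  refine strictMono_of_deriv_pos fun y => ?_
  have hd' := ((((hf (y + t)).hasDerivAt.comp_add_const y t).sub
    ((hf (y - t)).hasDerivAt.comp_sub_const y t)).const_mul (1 / (2 * t)))
  have hpos : 0 < 1 / (2 * t) * (deriv f (y + t) - deriv f (y - t)) :=
    mul_pos (by positivity) (sub_pos.2 (h y))
  exact hpos.trans_eq hd'.deriv.symm

/-- A continuous function that is negative, strictly increasing and unbounded below on `Iic a`, and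
positive, strictly increasing and unbounded above on `Ici b`, increases strictly across every
sufficiently long interval. -/
theorem exists_pos_forall_lt_of_strictMonoOn_tails {g : ℝ → ℝ} (hg : Continuous g) {a b : ℝ}
    (ha : ∀ x ≤ a, g x < 0) (hb : ∀ x, b ≤ x → 0 < g x)
    (hmono₁ : StrictMonoOn g (Set.Iic a)) (hunb₁ : ∀ M : ℝ, ∃ x ≤ a, g x < M)
    (hmono₂ : StrictMonoOn g (Set.Ici b)) (hunb₂ : ∀ M : ℝ, ∃ x, b ≤ x ∧ M < g x) :
    ∃ L > 0, ∀ u v, L ≤ v - u → g u < g v := by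
  obtain ⟨C, hC⟩ := (isCompact_Icc (a := a) (b := b)).exists_bound_of_continuousOn hg.continuousOn
  obtain ⟨A, hA, hgA⟩ := hunb₁ (-C)
  obtain ⟨B, hB, hgB⟩ := hunb₂ C
  refine ⟨|B - A| + 1, by positivity, fun u v huv => ?_⟩
  have hBA := le_abs_self (B - A)
  have huv' : u < v := by linarith [abs_nonneg (B - A)]
  rcases le_or_gt B v with hv | hv
  · have hbv : b ≤ v := hB.trans hv
    rcases le_or_gt b u with hu | hu
    · exact hmono₂ hu hbv huv'
    rcases le_or_gt u a with hu' | hu'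
    · exact (ha u hu').trans (hb v hbv)
    have h1 := (le_abs_self _).trans (hC u ⟨hu'.le, hu.le⟩)
    have h2 := hmono₂.monotoneOn hB hbv hv
    linarith
  · have huA : u ≤ A := by linarith
    have hua : u ≤ a := huA.trans hA
    rcases le_or_gt v a with hv' | hv'
    · exact hmono₁ hua hv' huv'
    rcases le_or_gt b v with hbv | hbv
    · exact (ha u hua).trans (hb v hbv)
    have h1 := (neg_le_abs _).trans (hC v ⟨hv'.le, hbv.le⟩)
    have h2 := hmono₁.monotoneOn hua hA huA
    linarith

/-- Convexification: under conditions (a)-(c) on `f'`, there exists `t₀ > 0` such that for all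
`t ≥ t₀` the Steklov regularization `μ(·,t)` is strictly convex. -/
theorem steklov_convexification (f : ℝ → ℝ) (hf : ContDiff ℝ 1 f) (a b : ℝ) (hab : a < b)
    (ha : ∀ x ≤ a, deriv f x < 0) (hb : ∀ x, b ≤ x → 0 < deriv f x)
    (hmono₁ : StrictMonoOn (deriv f) (Set.Iic a))
    (hunb₁ : ∀ M : ℝ, ∃ x ≤ a, deriv f x < M)
    (hmono₂ : StrictMonoOn (deriv f) (Set.Ici b))
    (hunb₂ : ∀ M : ℝ, ∃ x, b ≤ x ∧ M < deriv f x) :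
    ∃ t₀ > 0, ∀ t, t₀ ≤ t →
      StrictConvexOn ℝ Set.univ
        (fun y : ℝ => (1 / (2 * t)) * ∫ τ in (y - t)..(y + t), f τ) := by
  obtain ⟨L, hL, h⟩ := exists_pos_forall_lt_of_strictMonoOn_tails (hf.continuous_deriv le_rfl)
    ha hb hmono₁ hunb₁ hmono₂ hunb₂
  exact ⟨L, hL, fun t ht => strictConvexOn_steklov (hf.differentiable one_ne_zero)
    (hL.trans_le ht) fun y => h _ _ (by linarith)⟩
end

section
/- Let f(x) = x⁴ + c₃x³ + c₂x² + c₁x + c₀ be a monic quartic polynomial with real coefficients, and suppose f′(x₁) = f′(x₂) = 0 with x₁ ≠ x₂. Then: (i) f(x₁) < f(x₂) if and only if f″(x₁) > f″(x₂); (ii) f(x₁) = f(x₂) if and only if f″(x₁) = f″(x₂). -/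
theorem deriv_monic_quartic (c₀ c₁ c₂ c₃ : ℝ) :
    deriv (fun x : ℝ => x ^ 4 + c₃ * x ^ 3 + c₂ * x ^ 2 + c₁ * x + c₀) =
      fun x => 4 * x ^ 3 + 3 * c₃ * x ^ 2 + 2 * c₂ * x + c₁ := by
  funext x
  refine HasDerivAt.deriv ?_
  convert ((((hasDerivAt_pow 4 x).add ((hasDerivAt_pow 3 x).const_mul c₃)).add
    ((hasDerivAt_pow 2 x).const_mul c₂)).add ((hasDerivAt_id x).const_mul c₁)).add_const c₀ using 1
  norm_num
  ring

theorem deriv_cubic (a b c d : ℝ) :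
    deriv (fun x : ℝ => a * x ^ 3 + b * x ^ 2 + c * x + d) =
      fun x => 3 * a * x ^ 2 + 2 * b * x + c := by
  funext x
  refine HasDerivAt.deriv ?_
  convert ((((hasDerivAt_pow 3 x).const_mul a).add
    ((hasDerivAt_pow 2 x).const_mul b)).add ((hasDerivAt_id x).const_mul c)).add_const d using 1
  norm_num
  ring

/-- Curvature lemma for monic quartic polynomials: if `f'(x₁) = f'(x₂) = 0` with `x₁ ≠ x₂`,
then (i) `f(x₁) < f(x₂) ↔ f''(x₁) > f''(x₂)` and (ii) `f(x₁) = f(x₂) ↔ f''(x₁) = f''(x₂)`. -/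
theorem quartic_curvature (c₀ c₁ c₂ c₃ : ℝ) (f : ℝ → ℝ)
    (hf : f = fun x : ℝ => x ^ 4 + c₃ * x ^ 3 + c₂ * x ^ 2 + c₁ * x + c₀)
    (x₁ x₂ : ℝ) (hne : x₁ ≠ x₂) (h1 : deriv f x₁ = 0) (h2 : deriv f x₂ = 0) :
    (f x₁ < f x₂ ↔ deriv (deriv f) x₂ < deriv (deriv f) x₁) ∧
    (f x₁ = f x₂ ↔ deriv (deriv f) x₁ = deriv (deriv f) x₂) := by
  have hd : 0 < (x₂ - x₁) ^ 2 := by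
    have := sub_ne_zero.mpr hne.symm
    positivity
  have key : 12 * (f x₂ - f x₁) =
      (x₂ - x₁) ^ 2 * (deriv (deriv f) x₁ - deriv (deriv f) x₂) := by
    have hermite : 12 * (f x₂ - f x₁) = 6 * (x₂ - x₁) * (deriv f x₁ + deriv f x₂) +
        (x₂ - x₁) ^ 2 * (deriv (deriv f) x₁ - deriv (deriv f) x₂) := by
      rw [hf, deriv_monic_quartic, deriv_cubic]
      ring
    rw [hermite, h1, h2]
    ring
  constructor
  · rw [← sub_pos, ← sub_pos (b := deriv (deriv f) x₂),
      ← mul_pos_iff_of_pos_left (b := deriv (deriv f) x₁ - _) hd, ← key]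
    exact (mul_pos_iff_of_pos_left (by norm_num)).symm
  · constructor
    · intro h
      rw [h, sub_self, mul_zero] at key
      exact sub_eq_zero.mp ((mul_eq_zero.mp key.symm).resolve_left hd.ne')
    · intro h
      rw [h, sub_self, mul_zero] at key
      linarith
end

section
/- Let f(x) = x⁴ + a₂x² + a₁x + a₀ be a monic depressed quartic polynomial with real coefficients, and suppose f′(x) = f′(y) = 0 with x ≠ y. Then 12·(f(x) − f(y)) = (x − y)²·(f″(y) − f″(x)). -/
theorem deriv_depressed_quartic (a₀ a₁ a₂ : ℝ) :
    deriv (fun x : ℝ => x ^ 4 + a₂ * x ^ 2 + a₁ * x + a₀) =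
      fun x => 4 * x ^ 3 + 2 * a₂ * x + a₁ := by
  funext t
  have h := ((((hasDerivAt_id' t).pow 4).add (((hasDerivAt_id' t).pow 2).const_mul a₂)).add
    ((hasDerivAt_id' t).const_mul a₁)).add_const a₀
  refine HasDerivAt.deriv (h.congr_deriv ?_)
  norm_num
  ring

theorem deriv_depressed_cubic (a₁ a₂ : ℝ) :
    deriv (fun x : ℝ => 4 * x ^ 3 + 2 * a₂ * x + a₁) = fun x => 12 * x ^ 2 + 2 * a₂ := by
  funext t
  have h := ((((hasDerivAt_id' t).pow 3).const_mul 4).add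
    ((hasDerivAt_id' t).const_mul (2 * a₂))).add_const a₁
  refine HasDerivAt.deriv (h.congr_deriv ?_)
  norm_num
  ring


/-- For a monic depressed quartic polynomial with `f'(x) = f'(y) = 0`, `x ≠ y`, we have
`12·(f(x) − f(y)) = (x − y)²·(f''(y) − f''(x))`. -/
theorem depressed_quartic_identity (a₀ a₁ a₂ : ℝ) (f : ℝ → ℝ)
    (hf : f = fun x : ℝ => x ^ 4 + a₂ * x ^ 2 + a₁ * x + a₀)
    (x y : ℝ) (hne : x ≠ y) (hx : deriv f x = 0) (hy : deriv f y = 0) :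
    12 * (f x - f y) = (x - y) ^ 2 * (deriv (deriv f) y - deriv (deriv f) x) := by
  subst hf
  rw [deriv_depressed_quartic] at hx hy ⊢
  rw [deriv_depressed_cubic]
  linear_combination 6 * (x - y) * (hx + hy)
end

section
/- Let f(x) = x⁴ + a₂x² + a₁x + a₀ be a monic depressed quartic polynomial with a₂ < 0 and a₁ ≠ 0. If x₁ and x₂ are two distinct local minimizers of f, then x₁·x₂ < 0; moreover one of them is less than −√(−a₂/6) and the other is greater than √(−a₂/6). -/
theorem depressed_quartic_first_order (a₀ a₁ a₂ x : ℝ)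
    (h : IsLocalMin (fun x : ℝ => x ^ 4 + a₂ * x ^ 2 + a₁ * x + a₀) x) :
    4 * x ^ 3 + 2 * a₂ * x + a₁ = 0 := by
  refine h.hasDerivAt_eq_zero ?_
  have hd := (((hasDerivAt_pow 4 x).add ((hasDerivAt_pow 2 x).const_mul a₂)).add
    ((hasDerivAt_id' x).const_mul a₁)).add_const a₀
  refine hd.congr_deriv ?_
  norm_num
  ring

theorem depressed_quartic_second_order (a₀ a₁ a₂ x : ℝ) (hx : x ≠ 0)
    (h : IsLocalMin (fun x : ℝ => x ^ 4 + a₂ * x ^ 2 + a₁ * x + a₀) x) :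
    0 < 6 * x ^ 2 + a₂ := by
  have hcrit := depressed_quartic_first_order a₀ a₁ a₂ x h
  obtain ⟨ε, hε, hball⟩ := Metric.eventually_nhds_iff.mp h
  have hx' : 0 < |x| := abs_pos.mpr hx
  obtain ⟨t, ht, htlt⟩ := exists_between (lt_min one_pos (div_pos hε hx'))
  obtain ⟨ht1, htε⟩ := lt_min_iff.mp htlt
  have hmin := hball (y := x - t * x) (by
    rw [Real.dist_eq, sub_sub_cancel_left, abs_neg, abs_mul, abs_of_pos ht]
    exact (lt_div_iff₀ hx').mp htε)
  have hsq : 0 < t ^ 2 * x ^ 2 := by positivity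
  have hexp : 0 ≤ t ^ 2 * x ^ 2 * (6 * x ^ 2 + a₂ - t * (4 - t) * x ^ 2) := by
    linear_combination hmin - t * x * hcrit
  have hnonneg := nonneg_of_mul_nonneg_right hexp hsq
  have hpos : 0 < t * (4 - t) * x ^ 2 :=
    mul_pos (mul_pos ht (by linarith)) (by positivity)
  linarith


/-- Two distinct local minimizers of a monic depressed quartic (with `a₂ < 0`, `a₁ ≠ 0`)
have opposite signs; one lies below `−√(−a₂/6)` and the other above `√(−a₂/6)`. -/
theorem depressed_quartic_local_min_signs (a₀ a₁ a₂ : ℝ) (ha₂ : a₂ < 0) (ha₁ : a₁ ≠ 0)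
    (f : ℝ → ℝ) (hf : f = fun x : ℝ => x ^ 4 + a₂ * x ^ 2 + a₁ * x + a₀)
    (x₁ x₂ : ℝ) (hne : x₁ ≠ x₂) (h1 : IsLocalMin f x₁) (h2 : IsLocalMin f x₂) :
    x₁ * x₂ < 0 ∧
    ((x₁ < -Real.sqrt (-a₂ / 6) ∧ Real.sqrt (-a₂ / 6) < x₂) ∨
     (x₂ < -Real.sqrt (-a₂ / 6) ∧ Real.sqrt (-a₂ / 6) < x₁)) := by
  subst hf
  have c1 := depressed_quartic_first_order a₀ a₁ a₂ x₁ h1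
  have c2 := depressed_quartic_first_order a₀ a₁ a₂ x₂ h2
  have x₁_ne : x₁ ≠ 0 := by rintro rfl; exact ha₁ (by linarith)
  have x₂_ne : x₂ ≠ 0 := by rintro rfl; exact ha₁ (by linarith)
  have d1 := depressed_quartic_second_order a₀ a₁ a₂ x₁ x₁_ne h1
  have d2 := depressed_quartic_second_order a₀ a₁ a₂ x₂ x₂_ne h2
  have hsum : 4 * (x₁ ^ 2 + x₁ * x₂ + x₂ ^ 2) + 2 * a₂ = 0 :=
    mul_left_cancel₀ (sub_ne_zero.mpr hne) (by linear_combination c1 - c2)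
  have l1 : √(-a₂ / 6) < |x₁| := by
    rw [← Real.sqrt_sq_eq_abs]
    exact Real.sqrt_lt_sqrt (by linarith) (by linarith)
  have l2 : √(-a₂ / 6) < |x₂| := by
    rw [← Real.sqrt_sq_eq_abs]
    exact Real.sqrt_lt_sqrt (by linarith) (by linarith)
  have hneg : x₁ * x₂ < 0 := by
    by_contra! hnonneg
    have hprod : √(-a₂ / 6) * √(-a₂ / 6) ≤ |x₁| * |x₂| := by gcongr
    rw [Real.mul_self_sqrt (by linarith), ← abs_mul, abs_of_nonneg hnonneg] at hprod
    linarith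
  refine ⟨hneg, ?_⟩
  rcases mul_neg_iff.mp hneg with ⟨hp, hn⟩ | ⟨hn, hp⟩
  · rw [abs_of_pos hp] at l1
    rw [abs_of_neg hn] at l2
    exact Or.inr ⟨by linarith, l1⟩
  · rw [abs_of_neg hn] at l1
    rw [abs_of_pos hp] at l2
    exact Or.inl ⟨by linarith, l2⟩
end

section
/- Let f(x) = x⁴ + a₂x² + a₁x + a₀ be a monic depressed quartic polynomial with a₂ < 0 and a₁ ≠ 0, and let x* be a global minimizer of f (i.e., f(x*) ≤ f(y) for all y ∈ ℝ). Then (x*)² > −a₂/6 and a₁·x* < 0 (so that the sign of x* is opposite to the sign of a₁). -/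
/-- The first-order condition at a global minimizer of a depressed quartic. -/
lemma depressed_quartic_critical_of_global_min (a₀ a₁ a₂ x : ℝ)
    (hmin : ∀ y : ℝ, x ^ 4 + a₂ * x ^ 2 + a₁ * x + a₀ ≤ y ^ 4 + a₂ * y ^ 2 + a₁ * y + a₀) :
    4 * x ^ 3 + 2 * a₂ * x + a₁ = 0 := by
  have hd : HasDerivAt (fun y : ℝ => y ^ 4 + a₂ * y ^ 2 + a₁ * y + a₀)
      (4 * x ^ 3 + 2 * a₂ * x + a₁) x := by
    have h := ((((hasDerivAt_id' x).pow 4).add (((hasDerivAt_id' x).pow 2).const_mul a₂)).add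
      ((hasDerivAt_id' x).const_mul a₁)).add_const a₀
    refine h.congr_deriv ?_
    norm_num
    ring
  exact IsLocalMin.hasDerivAt_eq_zero (Filter.Eventually.of_forall hmin) hd

/-- The global minimizer `x*` of a monic depressed quartic with `a₂ < 0`, `a₁ ≠ 0` satisfies
`(x*)² > −a₂/6` and `a₁·x* < 0`. -/
theorem depressed_quartic_global_min_sign (a₀ a₁ a₂ : ℝ) (ha₂ : a₂ < 0) (ha₁ : a₁ ≠ 0)
    (f : ℝ → ℝ) (hf : f = fun x : ℝ => x ^ 4 + a₂ * x ^ 2 + a₁ * x + a₀)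
    (xs : ℝ) (hmin : ∀ y : ℝ, f xs ≤ f y) :
    -a₂ / 6 < xs ^ 2 ∧ a₁ * xs < 0 := by
  subst hf
  have hcrit := depressed_quartic_critical_of_global_min a₀ a₁ a₂ xs hmin
  have hx : xs ≠ 0 := by
    rintro rfl
    exact ha₁ (by linarith)
  have hle : a₁ * xs ≤ 0 := by
    have h := hmin (-xs)
    ring_nf at h
    linarith
  have hneg : a₁ * xs < 0 := lt_of_le_of_ne hle (mul_ne_zero ha₁ hx)
  have hprod : 0 < xs ^ 2 * (4 * xs ^ 2 + 2 * a₂) := by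
    linear_combination hneg - xs * hcrit
  have hpos := pos_of_mul_pos_right hprod (sq_nonneg xs)
  exact ⟨by linarith, hneg⟩
end

section
/- Let f(x) = x⁴ + a₂x² + a₁x + a₀ be a monic depressed quartic polynomial, and consider solutions (x,t) ∈ ℝ × [0,∞) of the system 4x³ + 2(a₂ + 2t²)x + a₁ = 0 and 12x² + 2(a₂ + 2t²) = 0 (i.e., μ_x(x,t) = 0 and μ_{xx}(x,t) = 0). (a) If a₂ > −(3/2)·|a₁|^{2/3}, the system has no solution with t ≥ 0. (b) If a₂ ≤ −(3/2)·|a₁|^{2/3}, the system has exactly one solution (x̂, t̂) with t̂ ≥ 0, given by x̂ := the unique real number with 8x̂³ = a₁ (i.e., x̂ = a₁^{1/3}/2) and t̂ := (1/2)·√(−(3|a₁|^{2/3} + 2a₂)). -/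
theorem rpow_one_third_sq_eight_mul_cube (x : ℝ) :
    ((8 * x ^ 3) ^ 2) ^ ((1 : ℝ) / 3) = 4 * x ^ 2 := by
  rw [show (8 * x ^ 3) ^ 2 = (4 * x ^ 2) ^ 3 by ring, one_div]
  exact Real.pow_rpow_inv_natCast (by positivity) three_ne_zero

/-- At a common zero of `μ_x` and `μ_xx`, the linear coefficient is determined by `x`. -/
theorem steklov_system_iff (a₁ a₂ x t : ℝ) :
    (4 * x ^ 3 + 2 * (a₂ + 2 * t ^ 2) * x + a₁ = 0 ∧ 12 * x ^ 2 + 2 * (a₂ + 2 * t ^ 2) = 0) ↔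
      8 * x ^ 3 = a₁ ∧ (2 * t) ^ 2 = -(3 * (4 * x ^ 2) + 2 * a₂) := by
  constructor
  · rintro ⟨h₁, h₂⟩
    exact ⟨by linear_combination x * h₂ - h₁, by linear_combination h₂⟩
  · rintro ⟨h₁, h₂⟩
    exact ⟨by linear_combination x * h₂ - h₁, by linear_combination h₂⟩

/-- Flatness lemma: solutions `(x,t) ∈ ℝ × [0,∞)` of `μ_x(x,t) = 0 ∧ μ_xx(x,t) = 0`.
(a) If `a₂ > −(3/2)|a₁|^{2/3}` there is no solution.
(b) If `a₂ ≤ −(3/2)|a₁|^{2/3}` the unique solution is `(x̂, t̂)` with `8x̂³ = a₁` and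
`t̂ = (1/2)√(−(3|a₁|^{2/3} + 2a₂))`.  Here `|a₁|^{2/3} = (a₁²)^{1/3}`. -/
theorem steklov_quartic_flatness (a₀ a₁ a₂ : ℝ) :
    ((-(3 / 2) * (a₁ ^ 2) ^ ((1 : ℝ) / 3) < a₂) →
      ¬ ∃ x t : ℝ, 0 ≤ t ∧ 4 * x ^ 3 + 2 * (a₂ + 2 * t ^ 2) * x + a₁ = 0 ∧
        12 * x ^ 2 + 2 * (a₂ + 2 * t ^ 2) = 0) ∧
    ((a₂ ≤ -(3 / 2) * (a₁ ^ 2) ^ ((1 : ℝ) / 3)) →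
      ∀ xhat : ℝ, 8 * xhat ^ 3 = a₁ →
      ∀ x t : ℝ, 0 ≤ t →
        ((4 * x ^ 3 + 2 * (a₂ + 2 * t ^ 2) * x + a₁ = 0 ∧
          12 * x ^ 2 + 2 * (a₂ + 2 * t ^ 2) = 0) ↔
          (x = xhat ∧
           t = (1 / 2) * Real.sqrt (-(3 * (a₁ ^ 2) ^ ((1 : ℝ) / 3) + 2 * a₂))))) := by
  refine ⟨?_, ?_⟩
  · rintro h ⟨x, t, -, hsys⟩
    obtain ⟨rfl, ht⟩ := (steklov_system_iff a₁ a₂ x t).1 hsys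
    rw [rpow_one_third_sq_eight_mul_cube] at h
    linarith [sq_nonneg (2 * t)]
  · rintro h y rfl x t ht
    rw [rpow_one_third_sq_eight_mul_cube] at h ⊢
    have hxy : 8 * x ^ 3 = 8 * y ^ 3 ↔ x = y := by
      rw [mul_right_inj' (by norm_num)]
      exact (Odd.strictMono_pow (by decide : Odd 3)).injective.eq_iff
    rw [steklov_system_iff, hxy]
    refine and_congr_right ?_
    rintro rfl
    rw [eq_comm, ← Real.sqrt_eq_iff_eq_sq (by linarith) (by linarith)]
    constructor <;> intro h' <;> linarith
end

section
/- Let h(x) = x⁴ + b₂x² + b₁x + b₀ be a monic depressed quartic polynomial with real coefficients. Then h is quasi-convex on ℝ if and only if the discriminant Δ := −16·(8b₂³ + 27b₁²) of h′(x) = 4x³ + 2b₂x + b₁ satisfies Δ ≤ 0 (equivalently, 8b₂³ + 27b₁² ≥ 0). Moreover, in this case b₂ ≥ −(3/2)·|b₁|^{2/3}. -/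
theorem hasDerivAt_depressed_quartic (b₀ b₁ b₂ x : ℝ) :
    HasDerivAt (fun x : ℝ => x ^ 4 + b₂ * x ^ 2 + b₁ * x + b₀)
      (4 * x ^ 3 + 2 * b₂ * x + b₁) x := by
  have h := ((((hasDerivAt_id x).pow 4).add (((hasDerivAt_id x).pow 2).const_mul b₂)).add
    ((hasDerivAt_id x).const_mul b₁)).add_const b₀
  refine h.congr_deriv ?_
  simp only [id]
  push_cast
  ring

/-- A depressed cubic that passes from a positive to a negative value has positive discriminant. -/
theorem depressed_cubic_discrim_pos_of_sign_change {b₁ b₂ p q : ℝ} (hpq : p < q)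
    (hp : 0 < 4 * p ^ 3 + 2 * b₂ * p + b₁) (hq : 4 * q ^ 3 + 2 * b₂ * q + b₁ < 0) :
    8 * b₂ ^ 3 + 27 * b₁ ^ 2 < 0 := by
  by_contra! hD
  have hb : b₂ < 0 := by
    by_contra! hb
    have h₁ : 0 ≤ (q - p) * (4 * (q ^ 2 + q * p + p ^ 2) + 2 * b₂) :=
      mul_nonneg (by linarith) (by nlinarith [sq_nonneg (q + p), sq_nonneg q, sq_nonneg p])
    nlinarith
  obtain ⟨s, hs, rfl⟩ : ∃ s : ℝ, 0 < s ∧ b₂ = -6 * s ^ 2 := by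
    refine ⟨√(-b₂ / 6), Real.sqrt_pos.2 (by linarith), ?_⟩
    rw [Real.sq_sqrt (by linarith)]
    ring
  have habs : 8 * s ^ 3 ≤ |b₁| := abs_le_of_sq_le_sq' (by rw [sq_abs]; nlinarith) (abs_nonneg b₁) |>.2
  have hmono : q ^ 2 + q * p + p ^ 2 < 3 * s ^ 2 := by
    by_contra! hc
    nlinarith [mul_nonneg (sub_nonneg.2 hpq.le) (sub_nonneg.2 hc)]
  rcases le_abs.1 habs with hb₁ | hb₁
  · have hq' : q < -2 * s := by
      by_contra! hc
      nlinarith [mul_nonneg (sq_nonneg (q - s)) (show 0 ≤ q + 2 * s by linarith)]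
    nlinarith
  · have hp' : 2 * s < p := by
      by_contra! hc
      nlinarith [mul_nonneg (sq_nonneg (p + s)) (show 0 ≤ 2 * s - p by linarith)]
    nlinarith

/-- A depressed cubic with positive discriminant has a root at which it is strictly decreasing. -/
theorem exists_depressed_cubic_root_deriv_neg {b₁ b₂ : ℝ} (hD : 8 * b₂ ^ 3 + 27 * b₁ ^ 2 < 0) :
    ∃ m : ℝ, 4 * m ^ 3 + 2 * b₂ * m + b₁ = 0 ∧ 6 * m ^ 2 + b₂ < 0 := by
  have hb : b₂ < 0 := by
    by_contra! hb
    nlinarith [pow_nonneg hb 3, sq_nonneg b₁]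
  obtain ⟨s, hs, rfl⟩ : ∃ s : ℝ, 0 < s ∧ b₂ = -6 * s ^ 2 := by
    refine ⟨√(-b₂ / 6), Real.sqrt_pos.2 (by linarith), ?_⟩
    rw [Real.sq_sqrt (by linarith)]
    ring
  have habs : |b₁| < 8 * s ^ 3 := abs_lt_of_sq_lt_sq (by nlinarith) (by positivity)
  obtain ⟨hl, hu⟩ := abs_lt.1 habs
  obtain ⟨m, ⟨hm₁, hm₂⟩, hm⟩ := intermediate_value_Ioo' (a := -s) (b := s) (by linarith)
    (f := fun x : ℝ => 4 * x ^ 3 + 2 * (-6 * s ^ 2) * x + b₁) (by fun_prop)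
    (show (0 : ℝ) ∈ _ from ⟨by nlinarith, by nlinarith⟩)
  exact ⟨m, hm, by nlinarith⟩

theorem quasiconvexOn_depressed_quartic {b₁ b₂ : ℝ} (b₀ : ℝ)
    (hD : 0 ≤ 8 * b₂ ^ 3 + 27 * b₁ ^ 2) :
    QuasiconvexOn ℝ Set.univ (fun x : ℝ => x ^ 4 + b₂ * x ^ 2 + b₁ * x + b₀) := by
  intro r
  refine Set.OrdConnected.convex ⟨?_⟩
  rintro x ⟨-, hx⟩ y ⟨-, hy⟩ z ⟨hxz, hzy⟩
  refine ⟨trivial, ?_⟩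
  by_contra! hz
  have hxz' : x < z := hxz.lt_of_ne (by rintro rfl; exact hz.not_ge hx)
  have hzy' : z < y := hzy.lt_of_ne (by rintro rfl; exact hz.not_ge hy)
  have hd := hasDerivAt_depressed_quartic b₀ b₁ b₂
  have hc : Continuous (fun x : ℝ => x ^ 4 + b₂ * x ^ 2 + b₁ * x + b₀) := by fun_prop
  obtain ⟨p, hp, hp'⟩ := exists_hasDerivAt_eq_slope _ _ hxz' hc.continuousOn fun t _ => hd t
  obtain ⟨q, hq, hq'⟩ := exists_hasDerivAt_eq_slope _ _ hzy' hc.continuousOn fun t _ => hd t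
  refine hD.not_gt (depressed_cubic_discrim_pos_of_sign_change (hp.2.trans hq.1) ?_ ?_)
  · rw [hp']
    exact div_pos (sub_pos.2 (hx.trans_lt hz)) (sub_pos.2 hxz')
  · rw [hq']
    exact div_neg_of_neg_of_pos (sub_neg.2 (hy.trans_lt hz)) (sub_pos.2 hzy')

theorem discrim_nonneg_of_quasiconvexOn {b₀ b₁ b₂ : ℝ}
    (h : QuasiconvexOn ℝ Set.univ (fun x : ℝ => x ^ 4 + b₂ * x ^ 2 + b₁ * x + b₀)) :
    0 ≤ 8 * b₂ ^ 3 + 27 * b₁ ^ 2 := by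
  by_contra! hD
  obtain ⟨m, hm, hm'⟩ := exists_depressed_cubic_root_deriv_neg hD
  have htaylor (t : ℝ) : (m + t) ^ 4 + b₂ * (m + t) ^ 2 + b₁ * (m + t) + b₀ =
      m ^ 4 + b₂ * m ^ 2 + b₁ * m + b₀ + t ^ 2 * (t ^ 2 + 4 * m * t + (6 * m ^ 2 + b₂)) := by
    linear_combination t * hm
  obtain ⟨t, ht, ht'⟩ : ∃ t : ℝ, 0 < t ∧ t ^ 2 + 4 * |m| * t + (6 * m ^ 2 + b₂) < 0 := by
    have hlim : Filter.Tendsto (fun t : ℝ => t ^ 2 + 4 * |m| * t + (6 * m ^ 2 + b₂))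
        (nhdsWithin 0 (Set.Ioi 0)) (nhds (6 * m ^ 2 + b₂)) := by
      refine Filter.Tendsto.mono_left ?_ nhdsWithin_le_nhds
      exact Continuous.tendsto' (by fun_prop) _ _ (by simp)
    exact (eventually_mem_nhdsWithin.and (hlim.eventually_lt_const hm')).exists
  have hlt (u : ℝ) (hu : |u| = t) : (m + u) ^ 4 + b₂ * (m + u) ^ 2 + b₁ * (m + u) + b₀ <
      m ^ 4 + b₂ * m ^ 2 + b₁ * m + b₀ := by
    have hu0 : u ≠ 0 := abs_pos.1 (hu ▸ ht)
    have hmu : m * u ≤ |m| * t := by rw [← hu, ← abs_mul]; exact le_abs_self _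
    have hsq : u ^ 2 = t ^ 2 := by rw [← hu, sq_abs]
    rw [htaylor]
    have := mul_neg_of_pos_of_neg (pow_pos ht 2)
      (show u ^ 2 + 4 * m * u + (6 * m ^ 2 + b₂) < 0 by linarith)
    rw [← hsq] at this
    linarith
  have h₁ := hlt (-t) (by rw [abs_neg, abs_of_pos ht])
  have h₂ := hlt t (abs_of_pos ht)
  have hmem := (h (max _ _)).ordConnected.out ⟨trivial, le_max_left _ _⟩
    ⟨trivial, le_max_right _ _⟩ (show m ∈ Set.Icc (m + -t) (m + t) from
      ⟨by linarith, by linarith⟩)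
  exact hmem.2.not_gt (max_lt h₁ h₂)

/-- Quasi-convexity of a monic depressed quartic `h`: `h` is quasi-convex iff the discriminant
`Δ = −16(8b₂³ + 27b₁²)` of `h'` is nonpositive; in this case `b₂ ≥ −(3/2)|b₁|^{2/3}`,
where `|b₁|^{2/3} = (b₁²)^{1/3}`. -/
theorem depressed_quartic_quasiconvex (b₀ b₁ b₂ : ℝ) (h : ℝ → ℝ)
    (hh : h = fun x : ℝ => x ^ 4 + b₂ * x ^ 2 + b₁ * x + b₀) :
    (QuasiconvexOn ℝ Set.univ h ↔ -16 * (8 * b₂ ^ 3 + 27 * b₁ ^ 2) ≤ 0) ∧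
    (QuasiconvexOn ℝ Set.univ h → -(3 / 2) * (b₁ ^ 2) ^ ((1 : ℝ) / 3) ≤ b₂) := by
  subst hh
  refine ⟨⟨fun h => ?_, fun hD => quasiconvexOn_depressed_quartic b₀ (by linarith)⟩, fun h => ?_⟩
  · linarith [discrim_nonneg_of_quasiconvexOn h]
  · have hD := discrim_nonneg_of_quasiconvexOn h
    have hu : ((b₁ ^ 2) ^ ((1 : ℝ) / 3)) ^ 3 = b₁ ^ 2 := by
      rw [← Real.rpow_mul_natCast (sq_nonneg b₁)]
      norm_num
    refine (Odd.strictMono_pow (R := ℝ) (n := 3) (by decide)).le_iff_le.1 ?_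
    simp only [mul_pow, hu]
    linarith
end

section
/- Let f(x) = x⁴ + a₂x² + a₁x + a₀ be a monic depressed quartic polynomial and let t > 0. Then the function x ↦ μ(x,t) = x⁴ + (a₂ + 2t²)x² + a₁x + a₀ + t²/3 + t⁴/5 is quasi-convex on ℝ if and only if t ≥ (1/2)·√( max{ 0, −(3|a₁|^{2/3} + 2a₂) } ). -/
theorem quasiconvexOn_univ_real_iff (f : ℝ → ℝ) :
    QuasiconvexOn ℝ Set.univ f ↔ ∀ x z y, x < z → z < y → f z ≤ max (f x) (f y) := by
  constructor
  · intro h x z y hxz hzy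
    have hr := (h (max (f x) (f y))).ordConnected
    exact (hr.out ⟨trivial, le_max_left _ _⟩ ⟨trivial, le_max_right _ _⟩
      ⟨hxz.le, hzy.le⟩).2
  · intro h r
    refine Set.OrdConnected.convex ⟨?_⟩
    rintro x ⟨-, hx⟩ y ⟨-, hy⟩ z ⟨hxz, hzy⟩
    refine ⟨trivial, ?_⟩
    rcases hxz.eq_or_lt with rfl | hxz
    · exact hx
    rcases hzy.eq_or_lt with rfl | hzy
    · exact hy
    exact (h x z y hxz hzy).trans (max_le hx hy)

theorem QuasiconvexOn.comp_neg_real {f : ℝ → ℝ} (h : QuasiconvexOn ℝ Set.univ f) :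
    QuasiconvexOn ℝ Set.univ (fun x => f (-x)) := by
  rw [quasiconvexOn_univ_real_iff] at h ⊢
  intro x z y hxz hzy
  rw [max_comm]
  exact h (-y) (-z) (-x) (neg_lt_neg hzy) (neg_lt_neg hxz)

theorem quartic_le_of_nonneg {b k e z y : ℝ} (hk : 0 ≤ k) (hb : 0 ≤ 2 * b + 3 * k ^ 2)
    (hz : 0 ≤ z) (hzy : z ≤ y) :
    z ^ 4 + b * z ^ 2 + k ^ 3 * z + e ≤ y ^ 4 + b * y ^ 2 + k ^ 3 * y + e := by
  have hp : 0 ≤ z + y := by linarith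
  have hslope : 0 ≤ (z + y) * (z ^ 2 + y ^ 2 + b) + k ^ 3 := by
    have h₁ : 0 ≤ (z + y - k) ^ 2 * (z + y + 2 * k) := by positivity
    have h₂ : 0 ≤ (z + y) * (2 * b + 3 * k ^ 2) := mul_nonneg hp hb
    have h₃ : 0 ≤ (z + y) * (z - y) ^ 2 := by positivity
    linear_combination h₁ / 2 + h₂ / 2 + h₃ / 2
  linear_combination mul_nonneg (sub_nonneg.2 hzy) hslope

theorem quartic_slope_nonneg_of_nonpos {b c x z y : ℝ} (hc : 0 ≤ c) (hxz : x < z) (hzy : z < y)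
    (hy : y ≤ 0) (h : 0 < (x + z) * (x ^ 2 + z ^ 2 + b) + c) :
    0 ≤ (z + y) * (z ^ 2 + y ^ 2 + b) + c := by
  by_contra! hneg
  have hB : 0 < z ^ 2 + y ^ 2 + b := by
    by_contra! hB
    nlinarith
  have hA : z ^ 2 + y ^ 2 + b ≤ x ^ 2 + z ^ 2 + b := by nlinarith
  nlinarith

theorem quasiconvexOn_quartic_iff (b e : ℝ) {k : ℝ} (hk : 0 ≤ k) :
    QuasiconvexOn ℝ Set.univ (fun x : ℝ => x ^ 4 + b * x ^ 2 + k ^ 3 * x + e) ↔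
      0 ≤ 2 * b + 3 * k ^ 2 := by
  rw [quasiconvexOn_univ_real_iff]
  constructor
  · intro h
    by_contra! hb
    have hb₀ : 0 < -b / 6 := by nlinarith
    obtain ⟨w, hw, rfl⟩ : ∃ w : ℝ, 0 < w ∧ b = -6 * w ^ 2 :=
      ⟨√(-b / 6), Real.sqrt_pos.2 hb₀, by rw [Real.sq_sqrt hb₀.le]; ring⟩
    have hkw : k < 2 * w := lt_of_pow_lt_pow_left₀ 2 (by positivity) (by linarith)
    have hD : k ^ 3 < 8 * w ^ 3 := by
      have := pow_lt_pow_left₀ hkw hk three_ne_zero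
      linarith
    have hc : 0 ≤ k ^ 3 := by positivity
    have hε₀ : 0 < (8 * w ^ 3 - k ^ 3) / (8 * w) := div_pos (by linarith) (by positivity)
    obtain ⟨ε, hε, hεw⟩ : ∃ ε : ℝ, 0 < ε ∧ 8 * w * ε ^ 2 = 8 * w ^ 3 - k ^ 3 :=
      ⟨√((8 * w ^ 3 - k ^ 3) / (8 * w)), Real.sqrt_pos.2 hε₀, by
        rw [Real.sq_sqrt hε₀.le]; field_simp⟩
    have hε_le : ε ≤ w := by
      refine (sq_le_sq₀ hε.le hw.le).1 ?_
      have : 0 ≤ w * (w ^ 2 - ε ^ 2) := by linarith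
      linarith [nonneg_of_mul_nonneg_right this hw]
    rcases le_max_iff.1 (h (-2 * w) (w - ε) (w + ε) (by linarith) (by linarith)) with h' | h'
    · have h₁ : 0 < (w + ε) * (2 * w ^ 2 - (w - ε) ^ 2) :=
        mul_pos (by linarith) (by nlinarith)
      have h₂ : 0 < (3 * w - ε) * ((w + ε) * (2 * w ^ 2 - (w - ε) ^ 2) + k ^ 3) :=
        mul_pos (by linarith) (by linarith)
      linarith
    · have h₁ : 0 < ε * (8 * w ^ 3 - k ^ 3) := mul_pos hε (by linarith)
      have h₂ : ε * (8 * w * ε ^ 2) = ε * (8 * w ^ 3 - k ^ 3) := by rw [hεw]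
      linarith
  · intro hb x z y hxz hzy
    by_contra! hlt
    obtain ⟨hx, hy⟩ := max_lt_iff.1 hlt
    have hz : z < 0 := by
      by_contra! hz
      exact absurd (quartic_le_of_nonneg hk hb hz hzy.le) hy.not_ge
    have hP : 0 < (x + z) * (x ^ 2 + z ^ 2 + b) + k ^ 3 := by
      refine pos_of_mul_pos_right (a := z - x) ?_ (by linarith)
      linear_combination hx
    have hc : 0 ≤ k ^ 3 := by positivity
    have hle : ∀ v, z < v → v ≤ 0 →
        z ^ 4 + b * z ^ 2 + k ^ 3 * z + e ≤ v ^ 4 + b * v ^ 2 + k ^ 3 * v + e := by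
      intro v hzv hv
      have := mul_nonneg (sub_nonneg.2 hzv.le) (quartic_slope_nonneg_of_nonpos hc hxz hzv hv hP)
      linear_combination this
    rcases le_total y 0 with hy₀ | hy₀
    · exact absurd (hle y hzy hy₀) hy.not_ge
    · exact absurd ((hle 0 hz le_rfl).trans (quartic_le_of_nonneg hk hb le_rfl hy₀)) hy.not_ge

theorem quasiconvexOn_quartic_iff_rpow (b c e : ℝ) :
    QuasiconvexOn ℝ Set.univ (fun x : ℝ => x ^ 4 + b * x ^ 2 + c * x + e) ↔
      0 ≤ 2 * b + 3 * (c ^ 2) ^ ((1 : ℝ) / 3) := by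
  wlog hc : 0 ≤ c generalizing c
  · rw [← neg_sq c, ← this (-c) (by linarith)]
    constructor <;> intro h <;> convert h.comp_neg_real using 2 <;> ring
  obtain ⟨k, hk, rfl⟩ : ∃ k : ℝ, 0 ≤ k ∧ k ^ 3 = c :=
    ⟨c ^ ((1 : ℝ) / 3), by positivity, by
      rw [← Real.rpow_natCast, ← Real.rpow_mul hc]; norm_num⟩
  have hroot : ((k ^ 3) ^ 2) ^ ((1 : ℝ) / 3) = k ^ 2 := by
    rw [← pow_mul, mul_comm, pow_mul, ← Real.rpow_natCast, ← Real.rpow_mul (by positivity)]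
    norm_num
  rw [hroot, quasiconvexOn_quartic_iff b e hk]

/-- Quasi-convexity of the Steklov regularization of a monic depressed quartic:
`μ(·,t)` is quasi-convex iff `t ≥ (1/2)√(max{0, −(3|a₁|^{2/3} + 2a₂)})`,
where `|a₁|^{2/3} = (a₁²)^{1/3}`. -/
theorem steklov_quartic_quasiconvex (a₀ a₁ a₂ : ℝ) (t : ℝ) (ht : 0 < t) :
    QuasiconvexOn ℝ Set.univ
        (fun x : ℝ =>
          x ^ 4 + (a₂ + 2 * t ^ 2) * x ^ 2 + a₁ * x + a₀ + t ^ 2 / 3 + t ^ 4 / 5)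
      ↔ (1 / 2) * Real.sqrt (max 0 (-(3 * (a₁ ^ 2) ^ ((1 : ℝ) / 3) + 2 * a₂))) ≤ t := by
  have h := quasiconvexOn_quartic_iff_rpow (a₂ + 2 * t ^ 2) a₁ (a₀ + t ^ 2 / 3 + t ^ 4 / 5)
  simp only [← add_assoc] at h
  rw [h, ← le_div_iff₀' (by norm_num), Real.sqrt_le_left (by positivity), max_le_iff]
  constructor
  · intro h
    exact ⟨by positivity, by linear_combination h⟩
  · rintro ⟨-, h⟩
    linear_combination h
end

section
/- Let a < b be real numbers and let x : ℝ → ℝ be continuous on [a,b] and differentiable at every point of (a,b], with sgn(x′(t)) = −sgn(x(t)) for all t ∈ (a,b]. If x(b) ≠ 0, then sgn(x(t)) = sgn(x(b)) for all t ∈ [a,b]; in particular x(t) ≠ 0 on [a,b] and x never changes sign there. -/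
theorem Real.mul_nonpos_of_sign_eq_neg_sign {u v : ℝ} (h : Real.sign v = -Real.sign u) :
    u * v ≤ 0 := by
  rcases lt_trichotomy u 0 with hu | hu | hu <;> rcases lt_trichotomy v 0 with hv | hv | hv <;>
    simp only [Real.sign_of_neg, Real.sign_of_pos, Real.sign_zero, hu, hv] at h <;>
    first | (norm_num at h; done) | nlinarith

/-- Where `x` and its derivative have opposite signs, `x ^ 2` is nonincreasing. -/
theorem antitoneOn_sq_of_sign_deriv_eq_neg_sign {a b : ℝ} {x : ℝ → ℝ}
    (hcont : ContinuousOn x (Set.Icc a b))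
    (hdiff : ∀ t ∈ Set.Ioo a b,
      DifferentiableAt ℝ x t ∧ Real.sign (deriv x t) = -Real.sign (x t)) :
    AntitoneOn (fun t => x t ^ 2) (Set.Icc a b) := by
  refine antitoneOn_of_hasDerivWithinAt_nonpos (convex_Icc a b) (hcont.pow 2)
    (f' := fun t => 2 * x t * deriv x t) ?_ ?_ <;> rw [interior_Icc] <;> intro t ht
  · simpa using ((hdiff t ht).1.hasDerivAt.fun_pow 2).hasDerivWithinAt
  · have := Real.mul_nonpos_of_sign_eq_neg_sign (hdiff t ht).2
    linarith

theorem Real.sign_eq_sign_of_continuousOn_of_ne_zero {s : Set ℝ} [s.OrdConnected] {f : ℝ → ℝ}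
    (hf : ContinuousOn f s) (h0 : ∀ t ∈ s, f t ≠ 0) {u v : ℝ} (hu : u ∈ s) (hv : v ∈ s) :
    Real.sign (f u) = Real.sign (f v) := by
  have hsub : Set.uIcc u v ⊆ s := Set.OrdConnected.uIcc_subset ‹_› hu hv
  have hzero : (0 : ℝ) ∉ Set.uIcc (f u) (f v) := fun h => by
    obtain ⟨t, ht, ht0⟩ := intermediate_value_uIcc (hf.mono hsub) h
    exact h0 t (hsub ht) ht0
  rw [Set.mem_uIcc] at hzero
  rcases (h0 u hu).lt_or_gt with h | h <;> rcases (h0 v hv).lt_or_gt with h' | h'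
  · rw [Real.sign_of_neg h, Real.sign_of_neg h']
  · exact absurd (Or.inl ⟨h.le, h'.le⟩) hzero
  · exact absurd (Or.inr ⟨h'.le, h.le⟩) hzero
  · rw [Real.sign_of_pos h, Real.sign_of_pos h']

/-- Sign lemma for ODE trajectories: if `x` is continuous on `[a,b]`, differentiable on `(a,b]`
with `sgn(x'(t)) = −sgn(x(t))` there, and `x(b) ≠ 0`, then `sgn(x(t)) = sgn(x(b))` on `[a,b]`;
in particular `x` never vanishes on `[a,b]`. -/
theorem trajectory_sign (a b : ℝ) (hab : a < b) (x : ℝ → ℝ)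
    (hcont : ContinuousOn x (Set.Icc a b))
    (hdiff : ∀ t ∈ Set.Ioc a b,
      DifferentiableAt ℝ x t ∧ Real.sign (deriv x t) = -Real.sign (x t))
    (hb : x b ≠ 0) :
    ∀ t ∈ Set.Icc a b, Real.sign (x t) = Real.sign (x b) ∧ x t ≠ 0 := by
  have hanti := antitoneOn_sq_of_sign_deriv_eq_neg_sign hcont
    fun t ht => hdiff t (Set.Ioo_subset_Ioc_self ht)
  have hbmem : b ∈ Set.Icc a b := Set.right_mem_Icc.2 hab.le
  have hne : ∀ t ∈ Set.Icc a b, x t ≠ 0 := fun t ht =>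
    sq_pos_iff.1 ((sq_pos_iff.2 hb).trans_le (hanti ht hbmem ht.2))
  exact fun t ht =>
    ⟨Real.sign_eq_sign_of_continuousOn_of_ne_zero hcont hne ht hbmem, hne t ht⟩
end

section
/- Let f(x) = x⁴ + a₂x² + a₁x + a₀ be a monic depressed quartic polynomial with a₂ < 0 and a₁ ≠ 0; set t₀ := √(−a₂/2) and let x₀ be the unique real with 4x₀³ + a₁ = 0. Let m₀ < t₀ and let x : ℝ → ℝ be continuous on [m₀,t₀] and differentiable at every point of (m₀,t₀], with x(t₀) = x₀ and, for all t ∈ (m₀,t₀], 6x(t)² + 2t² + a₂ ≠ 0 and x′(t) = −4t·x(t)/(6x(t)² + 2t² + a₂). Then 4x(t)³ + 2(a₂ + 2t²)x(t) + a₁ = 0 for all t ∈ [m₀,t₀], and 6x(t)² + 2t² + a₂ > 0 for all t ∈ (m₀,t₀]. -/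
/-- Trajectory along a valley: along a maximally extended solution of the ODE of Algorithm 2,
one has `μ_x(x(t),t) = 0` on `[m₀,t₀]` and `μ_xx(x(t),t) > 0` on `(m₀,t₀]`. -/
theorem trajectory_along_valley (a₀ a₁ a₂ : ℝ) (ha₂ : a₂ < 0) (ha₁ : a₁ ≠ 0)
    (t₀ : ℝ) (ht₀ : t₀ = Real.sqrt (-a₂ / 2))
    (x₀ : ℝ) (hx₀ : 4 * x₀ ^ 3 + a₁ = 0)
    (m₀ : ℝ) (hm₀ : m₀ < t₀) (x : ℝ → ℝ)
    (hcont : ContinuousOn x (Set.Icc m₀ t₀))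
    (hinit : x t₀ = x₀)
    (hode : ∀ t ∈ Set.Ioc m₀ t₀,
      6 * (x t) ^ 2 + 2 * t ^ 2 + a₂ ≠ 0 ∧
      HasDerivAt x (-(4 * t * x t) / (6 * (x t) ^ 2 + 2 * t ^ 2 + a₂)) t) :
    (∀ t ∈ Set.Icc m₀ t₀, 4 * (x t) ^ 3 + 2 * (a₂ + 2 * t ^ 2) * x t + a₁ = 0) ∧
    (∀ t ∈ Set.Ioc m₀ t₀, 0 < 6 * (x t) ^ 2 + 2 * t ^ 2 + a₂) := by
  have ht₀_sq : 2 * t₀ ^ 2 + a₂ = 0 := by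
    rw [ht₀, Real.sq_sqrt (by linarith)]
    ring
  have hx₀_ne : x₀ ≠ 0 := by
    rintro rfl
    exact ha₁ (by linarith)
  refine ⟨fun t ht => ?_, fun t ht => ?_⟩
  · have hend : 4 * x t₀ ^ 3 + 2 * (a₂ + 2 * t₀ ^ 2) * x t₀ + a₁ = 0 := by
      rw [hinit]
      linear_combination hx₀ + 2 * x₀ * ht₀_sq
    rcases ht.2.eq_or_lt with rfl | hlt
    · exact hend
    have hx : ContinuousOn x (Set.Icc t t₀) := hcont.mono (Set.Icc_subset_Icc_left ht.1)
    obtain ⟨c, -, hc⟩ := exists_hasDerivAt_eq_slope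
      (fun s => 4 * x s ^ 3 + 2 * (a₂ + 2 * s ^ 2) * x s + a₁) (fun _ => 0) hlt
      (by fun_prop) (fun s hs => by
        obtain ⟨hne, hd⟩ := hode s ⟨ht.1.trans_lt hs.1, hs.2.le⟩
        have hsq : HasDerivAt (fun s : ℝ => 2 * (a₂ + 2 * s ^ 2)) (8 * s) s :=
          ((((hasDerivAt_pow 2 s).const_mul 2).const_add a₂).const_mul 2).congr_deriv (by
            norm_num
            ring)
        have hq := div_mul_cancel₀ (-(4 * s * x s)) hne
        exact ((((hd.pow 3).const_mul 4).add (hsq.mul hd)).add_const a₁).congr_deriv (by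
          norm_num only [Nat.cast_ofNat]
          linear_combination 2 * hq))
    rw [hend, eq_comm, div_eq_zero_iff] at hc
    rcases hc with hc | hc <;> linarith
  · have hx : ContinuousOn x (Set.Ioc m₀ t₀) := hcont.mono Set.Ioc_subset_Icc_self
    have hpos : 0 < 6 * x t₀ ^ 2 + 2 * t₀ ^ 2 + a₂ := by
      rw [hinit]
      have : 0 < x₀ ^ 2 := by positivity
      linarith
    by_contra! hneg
    obtain ⟨s, hs, hs0⟩ := isPreconnected_Ioc.intermediate_value ht (Set.right_mem_Ioc.2 hm₀)
      (f := fun s => 6 * x s ^ 2 + 2 * s ^ 2 + a₂) (by fun_prop) ⟨hneg, hpos.le⟩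
    exact (hode s hs).1 hs0
end

section
/- Let f(x) = x⁴ + a₂x² + a₁x + a₀ be a monic depressed quartic polynomial with a₂ < 0 and a₁ ≠ 0; set t₀ := √(−a₂/2) and let x₀ be the unique real with 4x₀³ + a₁ = 0. Let m₀ < t₀ and let x : ℝ → ℝ be continuous on [m₀,t₀] and differentiable at every point of (m₀,t₀], with x(t₀) = x₀ and, for all t ∈ (m₀,t₀], 6x(t)² + 2t² + a₂ ≠ 0 and x′(t) = −4t·x(t)/(6x(t)² + 2t² + a₂). Then a₁·x(t) < 0 for all t ∈ [m₀,t₀]; that is, the trajectory never vanishes and its sign is everywhere opposite to the sign of a₁. -/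
/-- The ODE `(6x² + 2t² + a₂) x' = -4tx` is exact, with first integral `2x³ + (2t² + a₂)x`. -/
theorem quartic_trajectory_first_integral {a₂ s b : ℝ} (hsb : s ≤ b) {x : ℝ → ℝ}
    (hcont : ContinuousOn x (Set.Icc s b))
    (hode : ∀ t ∈ Set.Ioo s b,
      6 * (x t) ^ 2 + 2 * t ^ 2 + a₂ ≠ 0 ∧
      HasDerivAt x (-(4 * t * x t) / (6 * (x t) ^ 2 + 2 * t ^ 2 + a₂)) t) :
    2 * x s ^ 3 + (2 * s ^ 2 + a₂) * x s = 2 * x b ^ 3 + (2 * b ^ 2 + a₂) * x b := by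
  rcases hsb.eq_or_lt with rfl | hlt
  · rfl
  have hderiv : ∀ t ∈ Set.Ioo s b,
      HasDerivAt (fun t => 2 * x t ^ 3 + (2 * t ^ 2 + a₂) * x t) 0 t := by
    intro t ht
    obtain ⟨hne, hx⟩ := hode t ht
    have hd := div_mul_cancel₀ (-(4 * t * x t)) hne
    set d := -(4 * t * x t) / (6 * (x t) ^ 2 + 2 * t ^ 2 + a₂)
    have h := ((hx.pow 3).const_mul 2).add
      (((((hasDerivAt_id t).pow 2).const_mul 2).add_const a₂).mul hx)
    refine h.congr_deriv ?_
    simp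
    linear_combination hd
  obtain ⟨c, -, hc⟩ := exists_hasDerivAt_eq_slope
    (fun t => 2 * x t ^ 3 + (2 * t ^ 2 + a₂) * x t) (fun _ => 0) hlt (by fun_prop) hderiv
  have hne : b - s ≠ 0 := (sub_pos.2 hlt).ne'
  rw [eq_div_iff hne] at hc
  linarith


/-- Sign of a trajectory: along a solution of the ODE of Algorithm 2 on `[m₀,t₀]`,
one has `a₁ · x(t) < 0` everywhere; the trajectory never vanishes and its sign is opposite
to that of `a₁`. -/
theorem trajectory_sign_quartic (a₀ a₁ a₂ : ℝ) (ha₂ : a₂ < 0) (ha₁ : a₁ ≠ 0)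
    (t₀ : ℝ) (ht₀ : t₀ = Real.sqrt (-a₂ / 2))
    (x₀ : ℝ) (hx₀ : 4 * x₀ ^ 3 + a₁ = 0)
    (m₀ : ℝ) (hm₀ : m₀ < t₀) (x : ℝ → ℝ)
    (hcont : ContinuousOn x (Set.Icc m₀ t₀))
    (hinit : x t₀ = x₀)
    (hode : ∀ t ∈ Set.Ioc m₀ t₀,
      6 * (x t) ^ 2 + 2 * t ^ 2 + a₂ ≠ 0 ∧
      HasDerivAt x (-(4 * t * x t) / (6 * (x t) ^ 2 + 2 * t ^ 2 + a₂)) t) :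
    ∀ t ∈ Set.Icc m₀ t₀, a₁ * x t < 0 := by
  intro t ht
  have hint : ∀ s ∈ Set.Icc m₀ t₀, x s * (2 * x s ^ 2 + 2 * s ^ 2 + a₂) = 2 * x₀ ^ 3 := by
    intro s hs
    have h := quartic_trajectory_first_integral (a₂ := a₂) hs.2
      (hcont.mono (Set.Icc_subset_Icc_left hs.1))
      fun u hu => hode u ⟨hs.1.trans_lt hu.1, hu.2.le⟩
    have hsq : t₀ ^ 2 = -a₂ / 2 := by rw [ht₀, Real.sq_sqrt (by linarith)]
    rw [hsq, hinit] at h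
    linear_combination h
  have hx₀_ne : x₀ ≠ 0 := by
    rintro rfl
    exact ha₁ (by linarith)
  have hneg : a₁ * x t₀ < 0 := by
    have h : 0 < x₀ ^ 4 := by positivity
    rw [hinit, show a₁ * x₀ = -4 * x₀ ^ 4 by linear_combination x₀ * hx₀]
    linarith
  by_contra! hge
  have hcont' : ContinuousOn (fun s => a₁ * x s) (Set.Icc t t₀) :=
    continuousOn_const.mul (hcont.mono (Set.Icc_subset_Icc_left ht.1))
  obtain ⟨s, hs, hzero⟩ := intermediate_value_Icc' ht.2 hcont' ⟨hneg.le, hge⟩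
  have hxs : x s = 0 := (mul_eq_zero.1 hzero).resolve_left ha₁
  have h := hint s ⟨ht.1.trans hs.1, hs.2⟩
  rw [hxs, zero_mul] at h
  exact hx₀_ne (by simpa using h.symm)
end

section
/- Let f(x) = x⁴ + a₂x² + a₁x + a₀ be a monic depressed quartic polynomial with a₂ < 0 and a₁ ≠ 0; set t₀ := √(−a₂/2) and let x₀ be the unique real with 4x₀³ + a₁ = 0. Let x : ℝ → ℝ be continuous on [0,t₀] and differentiable at every point of (0,t₀], with x(t₀) = x₀ and, for all t ∈ (0,t₀], 6x(t)² + 2t² + a₂ ≠ 0 and x′(t) = −4t·x(t)/(6x(t)² + 2t² + a₂). Then x(0) is a global minimizer of f: f(x(0)) ≤ f(y) for all y ∈ ℝ. -/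
/-- A continuous function `g` on `[a, b]` whose derivative vanishes on `(a, b)` is constantly `g b`. -/
theorem eq_right_of_hasDerivAt_zero {g : ℝ → ℝ} {a b : ℝ} (hg : ContinuousOn g (Set.Icc a b))
    (hg' : ∀ t ∈ Set.Ioo a b, HasDerivAt g 0 t) {s : ℝ} (hs : s ∈ Set.Icc a b) : g s = g b := by
  rcases hs.2.eq_or_lt with rfl | hlt
  · rfl
  · obtain ⟨c, -, hc⟩ := exists_hasDerivAt_eq_slope g (fun _ => 0) hlt
      (hg.mono (Set.Icc_subset_Icc_left hs.1)) fun t ht => hg' t ⟨hs.1.trans_lt ht.1, ht.2⟩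
    have hne : b - s ≠ 0 := (sub_pos.mpr hlt).ne'
    field_simp at hc
    linarith

/-- A critical point of a depressed quartic whose sign is opposite to that of the linear
coefficient is a global minimizer. -/
theorem quartic_le_of_critical {a₀ a₁ a₂ c : ℝ} (hcrit : 4 * c ^ 3 + 2 * a₂ * c + a₁ = 0)
    (hsign : c * a₁ < 0) (y : ℝ) :
    c ^ 4 + a₂ * c ^ 2 + a₁ * c + a₀ ≤ y ^ 4 + a₂ * y ^ 2 + a₁ * y + a₀ := by
  have ha₁ : a₁ = -(4 * c ^ 3 + 2 * a₂ * c) := by linarith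
  have hpos : 0 < c ^ 2 * (2 * c ^ 2 + a₂) := by
    rw [ha₁] at hsign
    linarith
  have hfac : 0 < 2 * c ^ 2 + a₂ := pos_of_mul_pos_right hpos (sq_nonneg c)
  have hnonneg : 0 ≤ (y - c) ^ 2 * ((y + c) ^ 2 + (2 * c ^ 2 + a₂)) := by positivity
  rw [ha₁]
  linarith

/-- Well-definedness of Algorithm 2: the endpoint `x(0)` of the trajectory of the ODE
`ẋ(t) = −4t·x(t)/(6x(t)² + 2t² + a₂)` on `(0,t₀]` with `x(t₀) = x₀` is a global minimizer
of the monic depressed quartic `f`. -/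
theorem trajectory_global_minimizer (a₀ a₁ a₂ : ℝ) (ha₂ : a₂ < 0) (ha₁ : a₁ ≠ 0)
    (f : ℝ → ℝ) (hf : f = fun z : ℝ => z ^ 4 + a₂ * z ^ 2 + a₁ * z + a₀)
    (t₀ : ℝ) (ht₀ : t₀ = Real.sqrt (-a₂ / 2))
    (x₀ : ℝ) (hx₀ : 4 * x₀ ^ 3 + a₁ = 0)
    (x : ℝ → ℝ)
    (hcont : ContinuousOn x (Set.Icc 0 t₀))
    (hinit : x t₀ = x₀)
    (hode : ∀ t ∈ Set.Ioc (0 : ℝ) t₀,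
      6 * (x t) ^ 2 + 2 * t ^ 2 + a₂ ≠ 0 ∧
      HasDerivAt x (-(4 * t * x t) / (6 * (x t) ^ 2 + 2 * t ^ 2 + a₂)) t) :
    ∀ y : ℝ, f (x 0) ≤ f y := by
  have ht₀_nonneg : 0 ≤ t₀ := ht₀ ▸ Real.sqrt_nonneg _
  have ht₀_sq : t₀ ^ 2 = -a₂ / 2 := by
    rw [ht₀, Real.sq_sqrt (by linarith)]
  have hconserved : ∀ s ∈ Set.Icc 0 t₀,
      4 * x s ^ 3 + 2 * (a₂ + 2 * s ^ 2) * x s + a₁ = 0 := by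
    intro s hs
    have hconst := eq_right_of_hasDerivAt_zero
      (g := fun t => 4 * x t ^ 3 + 2 * (a₂ + 2 * t ^ 2) * x t + a₁) (by fun_prop)
      (fun t ht => by
        obtain ⟨hne, hx⟩ := hode t ⟨ht.1, ht.2.le⟩
        have hquad := (((hasDerivAt_pow 2 t).const_mul 2).const_add a₂).const_mul 2
        refine ((((hx.pow 3).const_mul 4).add (hquad.mul hx)).add_const a₁).congr_deriv ?_
        push_cast
        linear_combination 2 * div_mul_cancel₀ (-(4 * t * x t)) hne) hs
    simp only [hinit, ht₀_sq] at hconst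
    linarith
  have hx_ne : ∀ s ∈ Set.Icc 0 t₀, x s * a₁ ≠ 0 := by
    refine fun s hs => mul_ne_zero (fun h => ha₁ ?_) ha₁
    simpa [h] using hconserved s hs
  have hend : x t₀ * a₁ < 0 := by
    have hle : x t₀ * a₁ ≤ 0 := by
      rw [hinit, show a₁ = -(4 * x₀ ^ 3) by linarith]
      nlinarith [sq_nonneg (x₀ ^ 2)]
    exact lt_of_le_of_ne hle (hx_ne t₀ ⟨ht₀_nonneg, le_rfl⟩)
  have hstart : x 0 * a₁ < 0 := by
    by_contra! h
    obtain ⟨s, hs, hzero⟩ := intermediate_value_Icc' ht₀_nonneg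
      (hcont.mul continuousOn_const)
      (show (0 : ℝ) ∈ Set.Icc (x t₀ * a₁) (x 0 * a₁) from ⟨hend.le, h⟩)
    exact hx_ne s hs hzero
  intro y
  have hcrit := hconserved 0 ⟨le_rfl, ht₀_nonneg⟩
  subst hf
  exact quartic_le_of_critical (by linarith) hstart y
end
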